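/- Let n ≥ 3 be an integer, α ∈ (0,1), and η > 0. Then there is no nonzero vector λ = (λ₁,…,λₙ) ∈ ℝⁿ satisfying simultaneously: (i) |λ|² − (tr λ)²/(n−1) ≥ η·(tr λ)²; (ii) |λ|² − (tr λ)²/(n−2+α) ≤ 0; and (iii) Σ_{i,j=1}^n (λᵢλⱼ(λⱼ − λᵢ))² = 0. -/

import Mathlib

/-- The contradiction at the heart of the blow-up argument for
the Poincaré-type inequality: no nonzero vector `λ ∈ ℝⁿ` can simultaneously be
non-cylindrical (i), quadratically pinched (ii), and have vanishing Simons-type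
cubic (iii). -/
theorem no_nonzero_pinched_acylindrical_vector
    (n : ℕ) (hn : 3 ≤ n) (α η : ℝ) (hα0 : 0 < α) (hα1 : α < 1) (hη : 0 < η) :
    ¬ ∃ l : Fin n → ℝ, l ≠ 0 ∧
        (∑ i, (l i) ^ 2) - (∑ i, l i) ^ 2 / ((n : ℝ) - 1) ≥ η * (∑ i, l i) ^ 2 ∧
        (∑ i, (l i) ^ 2) - (∑ i, l i) ^ 2 / ((n : ℝ) - 2 + α) ≤ 0 ∧
        ∑ i, ∑ j, (l i * l j * (l j - l i)) ^ 2 = 0 := by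
  rintro ⟨l, hl, h1, h2, h3⟩
  obtain ⟨a, ha⟩ := Function.ne_iff.mp hl
  have ha' : l a ≠ 0 := ha
  have hk : ∀ j, l j = if l j ≠ 0 then l a else 0 := by
    intro j
    split_ifs with h
    · rw [Finset.sum_eq_zero_iff_of_nonneg
        (fun i _ => Finset.sum_nonneg fun j _ => sq_nonneg _)] at h3
      have h4 := h3 a (Finset.mem_univ _)
      rw [Finset.sum_eq_zero_iff_of_nonneg (fun j _ => sq_nonneg _)] at h4
      have h5 := pow_eq_zero_iff (two_ne_zero) |>.mp (h4 j (Finset.mem_univ _))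
      rcases mul_eq_zero.mp h5 with h6 | h6
      · exact absurd h6 (mul_ne_zero ha' h)
      · linarith
    · exact not_not.mp h
  obtain ⟨k, hkdef⟩ : ∃ k, k = (Finset.univ.filter fun j => l j ≠ 0).card := ⟨_, rfl⟩
  have hS1 : ∑ i, l i = k * l a := by
    rw [Finset.sum_congr rfl fun j _ => hk j, ← Finset.sum_filter, Finset.sum_const, hkdef,
      nsmul_eq_mul]
  have hS2 : ∑ i, (l i) ^ 2 = k * (l a) ^ 2 := by
    have : ∀ j, (l j) ^ 2 = if l j ≠ 0 then (l a) ^ 2 else 0 := by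
      intro j
      by_cases h : l j ≠ 0
      · have := hk j
        rw [if_pos h] at this ⊢
        rw [this]
      · rw [if_neg h, not_not.mp h]; norm_num
    rw [Finset.sum_congr rfl fun j _ => this j, ← Finset.sum_filter, Finset.sum_const, hkdef,
      nsmul_eq_mul]
  have hkpos : 0 < k := by
    rw [hkdef]
    exact Finset.card_pos.mpr ⟨a, by simpa using ha'⟩
  rw [hS1, hS2] at h1 h2
  have hkR : (0 : ℝ) < k := by exact_mod_cast hkpos
  have hnR : (3 : ℝ) ≤ n := by exact_mod_cast hn
  have hc : 0 < (l a) ^ 2 := by positivity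
  have hkc : 0 < (k : ℝ) * (l a) ^ 2 := by positivity
  have e1 : (k : ℝ) < n - 1 := by
    have hp : 0 < η * (k * l a) ^ 2 := by positivity
    have h : (k * l a) ^ 2 / ((n : ℝ) - 1) < k * (l a) ^ 2 := by linarith
    rw [div_lt_iff₀ (by linarith)] at h
    refine lt_of_mul_lt_mul_left (a := (k : ℝ) * (l a) ^ 2) ?_ hkc.le
    linarith [h, mul_pow (k : ℝ) (l a) 2, show (k : ℝ) * (l a) ^ 2 * k = (k * l a) ^ 2 by ring]
  have e2 : (n : ℝ) - 2 + α ≤ k := by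
    have h : k * (l a) ^ 2 ≤ (k * l a) ^ 2 / ((n : ℝ) - 2 + α) := by linarith
    rw [le_div_iff₀ (by linarith)] at h
    refine le_of_mul_le_mul_left (a := (k : ℝ) * (l a) ^ 2) ?_ hkc
    linarith [h, show (k : ℝ) * (l a) ^ 2 * k = (k * l a) ^ 2 by ring]
  have f1 : k + 1 < n := by
    have : (k : ℝ) + 1 < n := by linarith
    exact_mod_cast this
  have f2 : n < k + 2 := by
    have : (n : ℝ) < k + 2 := by linarith
    exact_mod_cast this
  omega
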